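/- Let G be a finite group, T and Q finite sets, and φ: T → CF(G), ψ: Q → CF(G) arbitrary maps. Let A be the T×Q-matrix with A_{tq} = ⟨φ(t), ψ(q)⟩. Then for every w ≥ 0 and all λ̲ ∈ PMap_w(T), μ̲ ∈ PMap_w(Q), one has ⟨ζ^{(φ)}_{λ̲}, ζ^{(ψ)}_{μ̲}⟩ = A^{≀w}(s,s)_{λ̲ μ̲}. -/

import Mathlib

open scoped BigOperators
open Classical

noncomputable section

/-- The number of maps `f` from the (indexed) parts of `mu` to the parts of `lam` such that for
every part `lam_i` of `lam`, the sum of the parts of `mu` in the fibre `f⁻¹(i)` equals `lam_i`.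
This is `|𝓜_{λμ}|` and also the value of the permutation character `h_λ` on the class of cycle
type `μ`. -/
def Mcount (lam mu : Multiset ℕ) : ℕ :=
  Fintype.card {f : Fin (Multiset.card mu) → Fin (Multiset.card lam) //
    ∀ i : Fin (Multiset.card lam),
      (∑ j ∈ Finset.univ.filter (fun j => f j = i), (mu.sort (· ≤ ·)).getD j 0)
        = (lam.sort (· ≤ ·)).getD i 0}

/-- `z_λ = ∏_i i^{m_i(λ)} m_i(λ)!`. -/
def zMult (lam : Multiset ℕ) : ℕ :=
  ∏ i ∈ lam.toFinset, i ^ lam.count i * (lam.count i).factorial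

/-- The cycle type of a permutation of `Fin n`, as the multiset of parts of a partition of `n`
(including the parts equal to `1` corresponding to fixed points). -/
def cycM {n : ℕ} (g : Equiv.Perm (Fin n)) : Multiset ℕ :=
  g.cycleType + Multiset.replicate (n - g.support.card) 1

/-- The value of the irreducible character `s_λ` of the symmetric group on the conjugacy class
of cycle type `nu`, given by the Jacobi–Trudi determinant `s_λ = det(h_{λ_i - i + j})_{i,j}`,
where `h_α` has value `Mcount α ν` on the class of cycle type `ν`. -/
def sval (lam nu : Multiset ℕ) : ℚ :=
  let L := (lam.sort (· ≤ ·)).reverse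
  let l := Multiset.card lam
  ∑ σ : Equiv.Perm (Fin l),
    ((Equiv.Perm.sign σ : ℤ) : ℚ) *
      (if ∀ i : Fin l, (i : ℕ) ≤ L.getD i 0 + (σ i : ℕ) then
        (Mcount ((Multiset.map (fun i : Fin l => L.getD i 0 + (σ i : ℕ) - (i : ℕ))
            (Finset.univ.val : Multiset (Fin l))).filter (fun x => x ≠ 0)) nu : ℚ)
       else 0)

/-- The irreducible character of `S_n` labelled by the partition `lam`, as a class function on
the symmetric group `S_n = Perm (Fin n)`. -/
def sFun {n : ℕ} (lam : Nat.Partition n) : Equiv.Perm (Fin n) → ℚ :=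
  fun g => sval lam.parts (cycM g)

/-- The usual scalar product of class functions on a finite group:
`⟨f, h⟩ = |G|⁻¹ ∑_{g ∈ G} f(g) h(g⁻¹)`. -/
def sp {G : Type*} [Group G] [Fintype G] (f h : G → ℚ) : ℚ :=
  (Fintype.card G : ℚ)⁻¹ * ∑ g : G, f g * h g⁻¹

/-- The class function `p_λ` on `S_w`: `p_λ(g_μ) = z_λ δ_{λμ}`. -/
def pFun {w : ℕ} (lam : Nat.Partition w) : Equiv.Perm (Fin w) → ℚ :=
  fun g => if cycM g = lam.parts then (zMult lam.parts : ℚ) else 0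

/-- The class function `p̃_λ = z_λ⁻¹ p_λ` on `S_w`: the indicator of the class of type `λ`. -/
def ptFun {w : ℕ} (lam : Nat.Partition w) : Equiv.Perm (Fin w) → ℚ :=
  fun g => if cycM g = lam.parts then 1 else 0

/-- The induced class function along an injection `ι : H → G` (underlying a subgroup inclusion):
`Ind φ (g) = |H|⁻¹ ∑_{x ∈ G} ∑_{h ∈ H, ι(h) = x g x⁻¹} φ(h)`. -/
def IndFun {H G : Type*} [Fintype H] [Fintype G] [Group G] (ι : H → G) (φ : H → ℚ) :
    G → ℚ :=
  fun g => (Fintype.card H : ℚ)⁻¹ * ∑ x : G, ∑ h : H, if ι h = x * g * x⁻¹ then φ h else 0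

/-- A bijection `Σ_i Fin (w_i) ≃ Fin w` when `∑_i w_i = w`, realising `Fin w` as the disjoint
union of blocks of sizes `w_i`. -/
def embSigma {η : Type*} [Fintype η] (ws : η → ℕ) {w : ℕ} (h : ∑ i, ws i = w) :
    (Σ i, Fin (ws i)) ≃ Fin w :=
  Fintype.equivOfCardEq (by simp [h])

/-- The wreath product `G ≀ S_w`: pairs `(x; σ)` with `x : Fin w → G`, `σ ∈ S_w`, and
multiplication `(x; σ)(y; τ) = (i ↦ x_i y_{σ⁻¹(i)}; στ)`. -/
def Wr (G : Type*) (w : ℕ) : Type _ := (Fin w → G) × Equiv.Perm (Fin w)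

instance (G : Type*) [Fintype G] (w : ℕ) : Fintype (Wr G w) :=
  inferInstanceAs (Fintype ((Fin w → G) × Equiv.Perm (Fin w)))

section WrGroup

variable {G : Type*} [Group G] {w : ℕ}

instance : Mul (Wr G w) := ⟨fun a b => (fun i => a.1 i * b.1 (a.2⁻¹ i), a.2 * b.2)⟩
instance : One (Wr G w) := ⟨((fun _ => 1), 1)⟩
instance : Inv (Wr G w) := ⟨fun a => (fun i => (a.1 (a.2 i))⁻¹, a.2⁻¹)⟩

instance : Group (Wr G w) :=
  Group.ofLeftAxioms
    (by
      rintro ⟨x, σ⟩ ⟨y, τ⟩ ⟨z, ρ⟩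
      refine Prod.ext ?_ (mul_assoc σ τ ρ)
      funext i
      show x i * y (σ⁻¹ i) * z ((σ * τ)⁻¹ i) = x i * (y (σ⁻¹ i) * z (τ⁻¹ (σ⁻¹ i)))
      rw [mul_assoc, mul_inv_rev]
      rfl)
    (by
      rintro ⟨x, σ⟩
      refine Prod.ext ?_ (one_mul σ)
      funext i
      show 1 * x ((1 : Equiv.Perm (Fin w))⁻¹ i) = x i
      simp)
    (by
      rintro ⟨x, σ⟩
      refine Prod.ext ?_ (inv_mul_cancel σ)
      funext i
      show (x (σ i))⁻¹ * x ((σ⁻¹)⁻¹ i) = 1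
      simp)

end WrGroup

/-- The product `x_i · x_{σ⁻¹(i)} ⋯ x_{σ^{-(n-1)}(i)}` along the cycle of `σ` through `i`
(`n` being the length of that cycle). -/
def cycleProd {G : Type*} [Group G] {w : ℕ} (x : Fin w → G) (σ : Equiv.Perm (Fin w))
    (i : Fin w) : G :=
  ((List.range (Finset.univ.filter (fun j => σ.SameCycle i j)).card).map
    (fun k => x ((σ⁻¹ ^ k) i))).prod

/-- The minimal representatives of the cycles of `σ` (one point in the support of each cycle,
including `1`-cycles). -/
def basepoints {w : ℕ} (σ : Equiv.Perm (Fin w)) : Finset (Fin w) :=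
  Finset.univ.filter (fun i => ∀ j, σ.SameCycle i j → i ≤ j)

/-- The class function `φ^{∼⊗w}` on `G ≀ S_w`: its value on an element equivalent to
`y_{σ_1}(x_1) ⋯ y_{σ_n}(x_n)` is `φ(x_1) ⋯ φ(x_n)`. -/
def tilprod {G : Type*} [Group G] {w : ℕ} (φ : G → ℚ) (g : Wr G w) : ℚ :=
  ∏ i ∈ basepoints g.2, φ (cycleProd g.1 g.2 i)

/-- The embedding of `∏_i (G ≀ S_{w_i})` into `G ≀ S_w` (as the underlying function of the
block-diagonal group embedding). -/
def embWr {G : Type*} [Group G] {η : Type*} [Fintype η] (ws : η → ℕ) {w : ℕ}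
    (h : ∑ i, ws i = w) (g : ∀ i, Wr G (ws i)) : Wr G w :=
  ((fun j => (g ((embSigma ws h).symm j).1).1 ((embSigma ws h).symm j).2),
   ((embSigma ws h).symm.trans
      ((Equiv.sigmaCongrRight (fun i => ((g i).2 : Fin (ws i) ≃ Fin (ws i)))).trans
        (embSigma ws h))))

/-- The class function `ζ_Ξ` on `G ≀ S_w` attached to a tuple `Ξ = ((φ_i, f_i))_i` with
`φ_i ∈ CF(G)` and `f_i ∈ CF(S_{w_i})`:
`ζ_Ξ = Ind_{∏_i G≀S_{w_i}}^{G≀S_w} ⊗_i (φ_i^{∼⊗w_i} · Inf f_i)`. -/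
def zetaTuple {G : Type*} [Group G] [Fintype G] {η : Type*} [Fintype η] (ws : η → ℕ)
    {w : ℕ} (h : ∑ i, ws i = w) (φs : η → (G → ℚ))
    (fs : ∀ i, Equiv.Perm (Fin (ws i)) → ℚ) : Wr G w → ℚ :=
  IndFun (embWr ws h) (fun g => ∏ i, tilprod (φs i) (g i) * fs i (g i).2)

/-- The type of all partitions (of arbitrary natural numbers). -/
abbrev PttAll : Type := Σ n : ℕ, Nat.Partition n

/-- Partitions of size at most `w`, with bounded first component (a finite type). -/
abbrev PBP (w : ℕ) : Type := (m : Fin (w + 1)) × Nat.Partition m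

/-- `PMap_w(T)`: the (finite) set of maps from `T` to partitions, of total size `w`. -/
abbrev PMapw (T : Type*) [Fintype T] (w : ℕ) : Type _ :=
  {lam : T → PBP w // ∑ t, ((lam t).1 : ℕ) = w}

/-- The scalar product on `Λ_ℚ = ⊕_w CF(S_w)` of two graded elements (the graded components
being orthogonal, this is zero when the degrees differ). -/
def pairCF {a b : ℕ} (f : Equiv.Perm (Fin a) → ℚ) (g : Equiv.Perm (Fin b) → ℚ) : ℚ :=
  if h : a = b then sp f (fun σ => g ((finCongr h).permCongr σ)) else 0

/-- The product in `Λ_ℚ` of a finite family of graded class functions: the class function on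
`S_w` induced from the outer tensor product on the Young subgroup `∏_i S_{w_i}`. -/
def multiProdCF {η : Type*} [Fintype η] (ws : η → ℕ) {w : ℕ} (h : ∑ i, ws i = w)
    (fs : ∀ i, Equiv.Perm (Fin (ws i)) → ℚ) : Equiv.Perm (Fin w) → ℚ :=
  IndFun (fun (g : ∀ i, Equiv.Perm (Fin (ws i))) =>
      ((embSigma ws h).symm.trans
        ((Equiv.sigmaCongrRight (fun i => (g i : Fin (ws i) ≃ Fin (ws i)))).trans
          (embSigma ws h)) : Equiv.Perm (Fin w)))
    (fun g => ∏ i, fs i (g i))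

/-- The `(λ̲, μ̲)`-entry of the matrix `A^{≀}(u, v)`:
`∑_{ν̲} (∏_t ⟨u_{λ̲(t)}, ∏_q p̃_{ν̲(t,q)}⟩) (∏_q ⟨v_{μ̲(q)}, ∏_t p_{ν̲(t,q)}⟩)
  (∏_{t,q} A_{tq}^{l(ν̲(t,q))})`,
the sum running over all maps `ν̲` from `T × Q` to partitions. -/
def wrGen {T Q : Type*} [Fintype T] [Fintype Q]
    (u v : ∀ n : ℕ, Nat.Partition n → Equiv.Perm (Fin n) → ℚ)
    (A : T → Q → ℚ) (lam : T → PttAll) (mu : Q → PttAll) : ℚ :=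
  ∑ᶠ nu : T × Q → PttAll,
    (∏ t : T, pairCF (u (lam t).1 (lam t).2)
        (multiProdCF (fun q => (nu (t, q)).1) rfl (fun q => ptFun (nu (t, q)).2))) *
    (∏ q : Q, pairCF (v (mu q).1 (mu q).2)
        (multiProdCF (fun t => (nu (t, q)).1) rfl (fun t => pFun (nu (t, q)).2))) *
    (∏ t : T, ∏ q : Q, A t q ^ (Multiset.card (nu (t, q)).2.parts))

/-- The `(λ̲, μ̲)`-entry of the matrix `A^{≀}(s, s)`. -/
def wrS {T Q : Type*} [Fintype T] [Fintype Q] (A : T → Q → ℚ)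
    (lam : T → PttAll) (mu : Q → PttAll) : ℚ :=
  wrGen (fun _ lam' => sFun lam') (fun _ lam' => sFun lam') A lam mu

/-- The matrix `A^{≀w}(s, s)`, the `PMap_w(T) × PMap_w(Q)`-submatrix of `A^{≀}(s, s)`. -/
def wrSMat {T Q : Type*} [Fintype T] [Fintype Q] (A : T → Q → ℚ) (w : ℕ) :
    Matrix (PMapw T w) (PMapw Q w) ℚ :=
  Matrix.of fun lam mu =>
    wrS A (fun t => ⟨(lam.1 t).1, (lam.1 t).2⟩) (fun q => ⟨(mu.1 q).1, (mu.1 q).2⟩)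

/-- A set of representatives for the cycles of a permutation. -/
def IsTr {α : Type*} (σ : Equiv.Perm α) (R : Finset α) : Prop :=
  ∀ i, ∃! r, r ∈ R ∧ σ.SameCycle i r

lemma basepoints_isTr {w : ℕ} (σ : Equiv.Perm (Fin w)) : IsTr σ (basepoints σ) := by
  intro i
  have hne : (Finset.univ.filter (fun j => σ.SameCycle i j)).Nonempty :=
    ⟨i, by simp [Equiv.Perm.SameCycle.refl]⟩
  have hm := Finset.min'_mem _ hne
  set m := Finset.min' _ hne with hmd
  have him : σ.SameCycle i m := by simpa using hm
  refine ⟨m, ⟨?_, him⟩, ?_⟩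
  · simp only [basepoints, Finset.mem_filter, Finset.mem_univ, true_and]
    intro j hj
    exact Finset.min'_le _ _ (by simpa using him.trans hj)
  · rintro r ⟨hr, hir⟩
    simp only [basepoints, Finset.mem_filter, Finset.mem_univ, true_and] at hr
    refine le_antisymm (hr m (hir.symm.trans him)) (Finset.min'_le _ _ (by simpa using hir))

lemma inv_same {α β : Type*} {σ : Equiv.Perm α} {F : α → β} (hF : ∀ i, F (σ i) = F i)
    {i j : α} (h : σ.SameCycle i j) : F i = F j := by
  obtain ⟨n, rfl⟩ := h
  have hF' : ∀ i, F (σ⁻¹ i) = F i := fun i => by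
    have := hF (σ⁻¹ i); simpa using this.symm
  have hn : ∀ (n : ℕ) i, F ((σ ^ n) i) = F i := by
    intro n; induction n with
    | zero => intro i; simp
    | succ n ih => intro i; rw [pow_succ, Equiv.Perm.mul_apply, ih, hF]
  have hn' : ∀ (n : ℕ) i, F ((σ⁻¹ ^ n) i) = F i := by
    intro n; induction n with
    | zero => intro i; simp
    | succ n ih => intro i; rw [pow_succ, Equiv.Perm.mul_apply, ih, hF']
  cases n with
  | ofNat n => simpa using (hn n i).symm
  | negSucc n => rw [zpow_negSucc, ← inv_pow]; exact (hn' _ i).symm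

@[to_additive]
lemma prod_tr {α M : Type*} [CommMonoid M] {σ : Equiv.Perm α} {R R' : Finset α}
    (h : IsTr σ R) (h' : IsTr σ R') (F : α → M) (hF : ∀ i, F (σ i) = F i) :
    ∏ i ∈ R, F i = ∏ i ∈ R', F i := by
  refine Finset.prod_bij' (fun r _ => (h' r).choose) (fun r _ => (h r).choose) ?_ ?_ ?_ ?_ ?_
  · intro a _; exact (h' a).choose_spec.1.1
  · intro a _; exact (h a).choose_spec.1.1
  · intro a ha
    exact ((h _).choose_spec.2 a ⟨ha, (h' a).choose_spec.1.2.symm⟩).symm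
  · intro a ha
    exact ((h' _).choose_spec.2 a ⟨ha, (h a).choose_spec.1.2.symm⟩).symm
  · intro a _; exact inv_same hF (h' a).choose_spec.1.2

lemma zpow_intertwine {α β : Type*} (e : α ≃ β) {σ : Equiv.Perm α} {τ : Equiv.Perm β}
    (hc : ∀ i, e (σ i) = τ (e i)) (n : ℤ) (i : α) : e ((σ ^ n) i) = (τ ^ n) (e i) := by
  have : τ = e.permCongrHom σ := by
    ext x; simp [Equiv.permCongrHom, hc]
  rw [this, ← map_zpow]; simp [Equiv.permCongrHom]

lemma sameCycle_intertwine {α β : Type*} (e : α ≃ β) {σ : Equiv.Perm α} {τ : Equiv.Perm β}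
    (hc : ∀ i, e (σ i) = τ (e i)) (i j : α) : τ.SameCycle (e i) (e j) ↔ σ.SameCycle i j := by
  unfold Equiv.Perm.SameCycle
  simp only [← zpow_intertwine e hc, EmbeddingLike.apply_eq_iff_eq]

lemma IsTr.map {α β : Type*} (e : α ≃ β) {σ : Equiv.Perm α} {τ : Equiv.Perm β}
    (hc : ∀ i, e (σ i) = τ (e i)) {R : Finset α} (h : IsTr σ R) :
    IsTr τ (R.map e.toEmbedding) := by
  intro i
  obtain ⟨i, rfl⟩ := e.surjective i
  obtain ⟨r, ⟨hr, hir⟩, hu⟩ := h i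
  refine ⟨e r, ⟨by simpa using hr, (sameCycle_intertwine e hc i r).2 hir⟩, ?_⟩
  intro y
  obtain ⟨y, rfl⟩ := e.surjective y
  rintro ⟨hy, hiy⟩
  rw [hu y ⟨by simpa using hy, (sameCycle_intertwine e hc i y).1 hiy⟩]

lemma sigma_zpow {η : Type*} {α : η → Type*} (h : ∀ t, Equiv.Perm (α t)) (n : ℤ)
    (x : Σ t, α t) :
    ((Equiv.sigmaCongrRight h : Equiv.Perm (Σ t, α t)) ^ n) x = ⟨x.1, ((h x.1) ^ n) x.2⟩ := by
  have : (Equiv.sigmaCongrRight h : Equiv.Perm (Σ t, α t))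
    = Equiv.Perm.sigmaCongrRightHom α h := rfl
  rw [this, ← map_zpow]; rfl

lemma sigma_sameCycle {η : Type*} {α : η → Type*} (h : ∀ t, Equiv.Perm (α t)) (x y : Σ t, α t) :
    Equiv.Perm.SameCycle (Equiv.sigmaCongrRight h : Equiv.Perm (Σ t, α t)) x y ↔
      ∃ j, (h x.1).SameCycle x.2 j ∧ y = ⟨x.1, j⟩ := by
  unfold Equiv.Perm.SameCycle
  simp only [sigma_zpow]
  constructor
  · rintro ⟨n, rfl⟩; exact ⟨_, ⟨n, rfl⟩, rfl⟩
  · rintro ⟨j, ⟨n, rfl⟩, rfl⟩; exact ⟨n, rfl⟩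

lemma IsTr.sigma {η : Type*} [Fintype η] {α : η → Type*} {h : ∀ t, Equiv.Perm (α t)}
    {R : ∀ t, Finset (α t)} (hR : ∀ t, IsTr (h t) (R t)) :
    IsTr (Equiv.sigmaCongrRight h : Equiv.Perm (Σ t, α t)) (Finset.univ.sigma R) := by
  rintro ⟨t, i⟩
  obtain ⟨r, ⟨hr, hir⟩, hu⟩ := hR t i
  refine ⟨⟨t, r⟩, ⟨by simpa using hr, (sigma_sameCycle h _ _).2 ⟨r, hir, rfl⟩⟩, ?_⟩
  rintro y ⟨hy, hiy⟩
  obtain ⟨j, hj, rfl⟩ := (sigma_sameCycle h _ _).1 hiy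
  rw [hu j ⟨by simpa using hy, hj⟩]

/-- The length of the cycle through `i`. -/
def len {α : Type*} [Fintype α] (σ : Equiv.Perm α) (i : α) : ℕ :=
  (Finset.univ.filter (fun j => σ.SameCycle i j)).card

lemma len_isCycleOn {α : Type*} [Fintype α] (σ : Equiv.Perm α) (i : α) :
    σ.IsCycleOn ((Finset.univ.filter (fun j => σ.SameCycle i j) : Finset α) : Set α) := by
  refine ⟨σ.bijOn (by simp), ?_⟩
  intro x hx y hy
  have hx' : σ.SameCycle i x := by simpa using hx
  have hy' : σ.SameCycle i y := by simpa using hy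
  exact hx'.symm.trans hy'

lemma pow_len {α : Type*} [Fintype α] (σ : Equiv.Perm α) (i : α) : (σ ^ len σ i) i = i :=
  (len_isCycleOn σ i).pow_card_apply (by simp [Equiv.Perm.SameCycle.refl])

lemma pow_eq_len {α : Type*} [Fintype α] (σ : Equiv.Perm α) (i : α) (n : ℕ) :
    (σ ^ n) i = i ↔ len σ i ∣ n :=
  (len_isCycleOn σ i).pow_apply_eq (by simp [Equiv.Perm.SameCycle.refl])

lemma len_pos {α : Type*} [Fintype α] (σ : Equiv.Perm α) (i : α) : 0 < len σ i :=
  Finset.card_pos.2 ⟨i, by simp [Equiv.Perm.SameCycle.refl]⟩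

lemma len_same {α : Type*} [Fintype α] (σ : Equiv.Perm α) (i : α) : len σ (σ i) = len σ i := by
  simp [len]

lemma len_inv {α : Type*} [Fintype α] (σ : Equiv.Perm α) (i : α) : len σ⁻¹ i = len σ i := by
  simp [len]

lemma len_intertwine {α β : Type*} [Fintype α] [Fintype β] (e : α ≃ β) {σ : Equiv.Perm α}
    {τ : Equiv.Perm β} (hc : ∀ i, e (σ i) = τ (e i)) (i : α) : len τ (e i) = len σ i := by
  refine (Finset.card_bij (fun a _ => e a) ?_ ?_ ?_).symm
  · intro a ha; simpa [sameCycle_intertwine e hc] using ha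
  · intro a _ b _ h; exact e.injective h
  · intro b hb
    obtain ⟨b, rfl⟩ := e.surjective b
    exact ⟨b, by simpa [sameCycle_intertwine e hc] using hb, rfl⟩

lemma len_sigma {η : Type*} [Fintype η] {α : η → Type*} [∀ t, Fintype (α t)]
    (h : ∀ t, Equiv.Perm (α t)) (t : η) (i : α t) :
    len (Equiv.sigmaCongrRight h : Equiv.Perm (Σ t, α t)) ⟨t, i⟩ = len (h t) i := by
  refine (Finset.card_bij (fun a _ => ⟨t, a⟩) ?_ ?_ ?_).symm
  · intro a ha
    simp only [Finset.mem_filter, Finset.mem_univ, true_and] at ha ⊢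
    exact (sigma_sameCycle h _ _).2 ⟨a, ha, rfl⟩
  · intro a _ b _ h; simpa using h
  · intro b hb
    simp only [Finset.mem_filter, Finset.mem_univ, true_and] at hb
    obtain ⟨j, hj, rfl⟩ := (sigma_sameCycle h _ _).1 hb
    exact ⟨j, by simpa using hj, rfl⟩

lemma basepoints_inv {w : ℕ} (σ : Equiv.Perm (Fin w)) : basepoints σ⁻¹ = basepoints σ := by
  simp [basepoints]

/-- The cycle type as a sum over base points. -/
lemma cycM_eq {n : ℕ} (g : Equiv.Perm (Fin n)) :
    cycM g = ∑ b ∈ basepoints g, ({len g b} : Multiset ℕ) := by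
  have hb := basepoints_isTr g
  rw [← Finset.sum_filter_add_sum_filter_not (basepoints g) (fun b => g b ≠ b)]
  unfold cycM
  congr 1
  · rw [Equiv.Perm.cycleType_def, ← Multiset.sum_map_singleton (Multiset.map _ _),
      Multiset.map_map]
    change ∑ c ∈ g.cycleFactorsFinset, ({c.support.card} : Multiset ℕ) = _
    symm
    refine Finset.sum_bij (fun b _ => g.cycleOf b) ?_ ?_ ?_ ?_
    · intro b hb'
      rw [Finset.mem_filter] at hb'
      rw [Equiv.Perm.cycleOf_mem_cycleFactorsFinset_iff, Equiv.Perm.mem_support]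
      exact hb'.2
    · intro a ha b hb' hab
      rw [Finset.mem_filter] at ha hb'
      have hs : g.SameCycle a b := by
        have : b ∈ (g.cycleOf a).support := by
          rw [hab, Equiv.Perm.mem_support_cycleOf_iff]
          exact ⟨Equiv.Perm.SameCycle.refl _ _, Equiv.Perm.mem_support.2 hb'.2⟩
        exact (Equiv.Perm.mem_support_cycleOf_iff.1 this).1
      exact (hb a).unique ⟨ha.1, Equiv.Perm.SameCycle.refl _ _⟩ ⟨hb'.1, hs⟩
    · intro c hc
      obtain ⟨a, ha⟩ := (Equiv.Perm.mem_cycleFactorsFinset_iff.1 hc).1.nonempty_support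
      have hca := Equiv.Perm.cycle_is_cycleOf ha hc
      obtain ⟨r, ⟨hr, har⟩, -⟩ := hb a
      have hga : g a ≠ a := by
        rw [← Equiv.Perm.mem_support]
        exact Equiv.Perm.mem_cycleFactorsFinset_support_le hc ha
      refine ⟨r, ?_, ?_⟩
      · rw [Finset.mem_filter]
        exact ⟨hr, fun h => hga (har.apply_eq_self_iff.2 h)⟩
      · rw [hca]; exact har.symm.cycleOf_eq
    · intro b hb'
      rw [Finset.mem_filter] at hb'
      congr 1
      unfold len
      congr 1
      ext j
      simp only [Finset.mem_filter, Finset.mem_univ, true_and]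
      rw [Equiv.Perm.mem_support_cycleOf_iff]
      simp [hb'.2]
  · have h1 : ∀ b ∈ (basepoints g).filter (fun b => ¬ g b ≠ b), ({len g b} : Multiset ℕ) = {1} := by
      intro b hb'
      rw [Finset.mem_filter, not_not] at hb'
      have := (pow_eq_len g b 1).1 (by simpa using hb'.2)
      rw [Nat.dvd_one.1 this]
    rw [Finset.sum_congr rfl h1, Finset.sum_const, Multiset.nsmul_singleton]
    congr 1
    have : (basepoints g).filter (fun b => ¬ g b ≠ b) = g.supportᶜ := by
      ext b
      simp only [Finset.mem_filter, not_not, Finset.mem_compl, Equiv.Perm.mem_support,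
        and_iff_right_iff_imp]
      intro h
      simp only [basepoints, Finset.mem_filter, Finset.mem_univ, true_and]
      intro j hj
      exact (hj.eq_of_left h).le
    rw [this, Finset.card_compl, Fintype.card_fin]

lemma cycM_inv {n : ℕ} (g : Equiv.Perm (Fin n)) : cycM g⁻¹ = cycM g := by
  simp [cycM]

lemma cycM_sum {n : ℕ} (g : Equiv.Perm (Fin n)) : (cycM g).sum = n := by
  have := g.partition.parts_sum
  rw [Equiv.Perm.parts_partition] at this
  simpa [cycM] using this

lemma class_card {n : ℕ} (nu : Nat.Partition n) :
    (Finset.univ.filter (fun g : Equiv.Perm (Fin n) => cycM g = nu.parts)).card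
      * zMult nu.parts = n.factorial := by
  set m := nu.parts.filter (fun i => 2 ≤ i) with hm
  set k := n - m.sum with hk
  have hdec : nu.parts = m + Multiset.replicate (nu.parts.count 1) 1 := by
    rw [← Multiset.filter_eq' nu.parts 1]
    rw [← Multiset.filter_add_not (fun i => 2 ≤ i) nu.parts]
    simp only [Multiset.filter_add, Multiset.filter_filter, hm]
    rw [Multiset.filter_congr (q := fun i => i = 1) (s := nu.parts) (p := fun i => ¬ 2 ≤ i)]
    · congr 1
      symm
      have : Multiset.filter (fun a => a = 1 ∧ 2 ≤ a) nu.parts = 0 := by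
        rw [Multiset.filter_eq_nil]; intro a _; omega
      rw [this, zero_add]
      apply Multiset.filter_congr; intro a _; omega
    · intro a ha; have := nu.parts_pos ha; omega
  have hsum : m.sum + nu.parts.count 1 = n := by
    have := nu.parts_sum
    rw [hdec] at this
    simpa using this
  have hk1 : nu.parts.count 1 = k := by omega
  rw [hk1] at hdec
  have hfil : ∀ g : Equiv.Perm (Fin n), cycM g = nu.parts ↔ g.cycleType = m := by
    intro g
    constructor
    · intro h
      have := Equiv.Perm.filter_parts_partition_eq_cycleType (σ := g)
      rw [Equiv.Perm.parts_partition, Fintype.card_fin] at this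
      rw [← this, hm, ← h, cycM]
    · intro h
      rw [cycM, hdec, hk, ← h, Equiv.Perm.sum_cycleType]
  simp only [hfil]
  have hz : zMult nu.parts = (Fintype.card (Fin n) - m.sum).factorial * m.prod
      * (∏ i ∈ m.toFinset, (m.count i).factorial) := by
    have h1 : nu.parts.prod = m.prod := by rw [hdec]; simp
    have h1m : (1 : ℕ) ∉ m := by simp [hm]
    unfold zMult
    rw [Finset.prod_mul_distrib, ← Finset.prod_multiset_count, h1, Fintype.card_fin, ← hk]
    have h2 : ∏ i ∈ nu.parts.toFinset, (nu.parts.count i).factorial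
        = ∏ i ∈ insert 1 m.toFinset, (nu.parts.count i).factorial := by
      apply Finset.prod_subset
      · intro i hi
        rw [Multiset.mem_toFinset, hdec, Multiset.mem_add] at hi
        rw [Finset.mem_insert, Multiset.mem_toFinset]
        rcases hi with hi | hi
        · exact Or.inr hi
        · exact Or.inl (Multiset.eq_of_mem_replicate hi)
      · intro i _ hi
        rw [Multiset.mem_toFinset] at hi
        simp [Multiset.count_eq_zero_of_notMem hi]
    rw [h2, Finset.prod_insert (by simpa using h1m), hk1]
    rw [mul_left_comm, mul_assoc]
    congr 2
    apply Finset.prod_congr rfl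
    intro i hi
    have : i ≠ 1 := by rintro rfl; exact h1m (by simpa using hi)
    rw [hdec, Multiset.count_add, Multiset.count_replicate, if_neg (Ne.symm this), add_zero]
  rw [hz]
  have := Equiv.Perm.card_of_cycleType_mul_eq (Fin n) m
  rw [if_pos] at this
  · rw [Fintype.card_fin] at this ⊢
    convert this
  · rw [Fintype.card_fin]
    exact ⟨by omega, by simp [hm]⟩

lemma class_cardQ {n : ℕ} (nu : Nat.Partition n) :
    ((Finset.univ.filter (fun g : Equiv.Perm (Fin n) => cycM g = nu.parts)).card : ℚ)
      * zMult nu.parts = n.factorial := by exact_mod_cast class_card nu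

/-- Block permutation. -/
def blk {P : Type*} {n : P → ℕ} {w : ℕ} (x : (Σ p, Fin (n p)) ≃ Fin w)
    (h : ∀ p, Equiv.Perm (Fin (n p))) : Equiv.Perm (Fin w) :=
  (x.symm.trans ((Equiv.sigmaCongrRight (fun i => (h i : Fin (n i) ≃ Fin (n i)))).trans x))

section blk
set_option linter.unusedSectionVars false
variable {P : Type*} [Fintype P] {n : P → ℕ} {w : ℕ} (x : (Σ p, Fin (n p)) ≃ Fin w)
  (h : ∀ p, Equiv.Perm (Fin (n p)))

lemma blk_apply (y) : blk x h (x y) = x ⟨y.1, h y.1 y.2⟩ := by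
  simp [blk]

lemma blk_comm (y) : x ((Equiv.sigmaCongrRight h : Equiv.Perm (Σ p, Fin (n p))) y)
    = blk x h (x y) := by
  simp [blk]

lemma blk_col (j) : (x.symm (blk x h j)).1 = (x.symm j).1 := by
  simp [blk]

lemma len_blk (p) (i : Fin (n p)) : len (blk x h) (x ⟨p, i⟩) = len (h p) i := by
  rw [len_intertwine x (blk_comm x h), len_sigma]

@[to_additive]
lemma blk_prod {M : Type*} [CommMonoid M] (F : Fin w → M) (hF : ∀ i, F (blk x h i) = F i) :
    ∏ b ∈ basepoints (blk x h), F b = ∏ p, ∏ b ∈ basepoints (h p), F (x ⟨p, b⟩) := by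
  have h1 : IsTr (Equiv.sigmaCongrRight h : Equiv.Perm (Σ p, Fin (n p))) _ :=
    IsTr.sigma (fun p => basepoints_isTr (h p))
  rw [prod_tr (basepoints_isTr _) (h1.map x (blk_comm x h)) F hF, Finset.prod_map,
    Finset.prod_sigma]
  rfl

/-- cycle type of the part of colour `p` -/
def Tc {P : Type*} {w : ℕ} (σ : Equiv.Perm (Fin w)) (c : Fin w → P) (p : P) : Multiset ℕ :=
  ∑ b ∈ basepoints σ, if c b = p then {len σ b} else 0

lemma Tc_blk (p) : Tc (blk x h) (fun j => (x.symm j).1) p = cycM (h p) := by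
  unfold Tc
  rw [blk_sum]
  · simp only [len_blk, Equiv.symm_apply_apply]
    rw [Finset.sum_eq_single p]
    · simp [cycM_eq]
    · intro q _ hq; simp [hq]
    · simp
  · intro i; simp only [blk_col, len_same]

lemma cycM_blk : cycM (blk x h) = ∑ p, cycM (h p) := by
  rw [cycM_eq, blk_sum]
  · simp only [len_blk, cycM_eq]
  · intro i; rw [len_same]

lemma blk_inj : Function.Injective (blk x) := by
  intro h h' hh
  funext p
  refine Equiv.ext fun i => ?_
  have := congrArg (fun σ => σ (x ⟨p, i⟩)) hh
  simp only [blk_apply] at this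
  simpa using this

lemma blk_surj (σ : Equiv.Perm (Fin w)) (hσ : ∀ j, (x.symm (σ j)).1 = (x.symm j).1) :
    ∃ h, blk x h = σ := by
  have h1 : ∀ p (i : Fin (n p)), ∃ j, σ (x ⟨p, i⟩) = x ⟨p, j⟩ := by
    intro p i
    have := hσ (x ⟨p, i⟩)
    rw [Equiv.symm_apply_apply] at this
    obtain ⟨y, hy⟩ := x.surjective (σ (x ⟨p, i⟩))
    rw [← hy, Equiv.symm_apply_apply] at this
    obtain ⟨q, j⟩ := y
    obtain rfl : q = p := this
    exact ⟨j, hy.symm⟩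
  choose f hf using h1
  have hinj : ∀ p, Function.Injective (f p) := by
    intro p i j hij
    have h2 : σ (x ⟨p, i⟩) = σ (x ⟨p, j⟩) := by rw [hf, hf, hij]
    simpa using h2
  refine ⟨fun p => Equiv.ofBijective (f p) (Finite.injective_iff_bijective.1 (hinj p)), ?_⟩
  refine Equiv.ext fun j => ?_
  obtain ⟨⟨p, i⟩, rfl⟩ := x.surjective j
  rw [blk_apply, hf]; rfl

lemma sum_blk (Ψ : Equiv.Perm (Fin w) → ℚ) :
    ∑ σ, (if ∀ j, (x.symm (σ j)).1 = (x.symm j).1 then Ψ σ else 0) = ∑ h, Ψ (blk x h) := by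
  rw [← Finset.sum_filter]
  symm
  refine Finset.sum_bij (fun h _ => blk x h) ?_ ?_ ?_ ?_
  · intro h _; simpa using blk_col x h
  · intro h _ h' _ hh; exact blk_inj x hh
  · intro σ hσ
    obtain ⟨h, hh⟩ := blk_surj x σ (by simpa using hσ)
    exact ⟨h, Finset.mem_univ _, hh⟩
  · intro _ _; rfl

lemma col_card (p) : (Finset.univ.filter (fun j => (x.symm j).1 = p)).card = n p := by
  have : (Finset.univ : Finset (Fin (n p))).card = n p := by simp
  refine Eq.trans (Eq.symm ?_) this
  refine Finset.card_bij (fun i _ => x ⟨p, i⟩) ?_ ?_ ?_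
  · intro i _; simp
  · intro i _ j _ hij; simpa using hij
  · intro j hj
    obtain ⟨⟨q, i⟩, rfl⟩ := x.surjective j
    obtain rfl : q = p := by simpa using hj
    exact ⟨i, by simp, rfl⟩

lemma equiv_count (e : Fin w → P) :
    ((Finset.univ.filter (fun x : (Σ p, Fin (n p)) ≃ Fin w =>
        (fun j => (x.symm j).1) = e)).card : ℚ)
      = if (∀ p, (Finset.univ.filter (fun j => e j = p)).card = n p) then
          ∏ p, ((n p).factorial : ℚ) else 0 := by
  split_ifs with hs
  · have hc : ∀ p, Nonempty (Fin (n p) ≃ {a // e a = p}) := by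
      intro p
      refine ⟨Fintype.equivOfCardEq ?_⟩
      rw [Fintype.card_fin, Fintype.card_subtype, hs]
    let f := fun p => (hc p).some
    let x0 : (Σ p, Fin (n p)) ≃ Fin w := (Equiv.sigmaCongrRight f).trans (Equiv.sigmaFiberEquiv e)
    have hx0 : (fun j => (x0.symm j).1) = e := by
      funext j
      obtain ⟨⟨p, i⟩, rfl⟩ := x0.surjective j
      rw [Equiv.symm_apply_apply]
      exact ((f p i).2).symm
    have h2 := sum_blk x0 (fun _ => 1)
    rw [← Finset.sum_filter] at h2
    simp only [Finset.sum_const, nsmul_eq_mul, mul_one, Finset.card_univ, Fintype.card_pi,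
      Fintype.card_perm, Fintype.card_fin, Nat.cast_prod] at h2
    rw [← h2]
    norm_cast
    refine Finset.card_bij' (fun x _ => x.symm.trans x0) (fun σ _ => x0.trans σ.symm) ?_ ?_ ?_ ?_
    · intro x hx
      simp only [Finset.mem_filter, Finset.mem_univ, true_and] at hx ⊢
      intro j
      rw [← hx] at hx0
      simpa using (congrFun hx0 j).symm
    · intro σ hσ
      simp only [Finset.mem_filter, Finset.mem_univ, true_and] at hσ ⊢
      rw [← hx0]
      funext j
      simpa using hσ j
    · intro x _; ext; simp
    · intro x _; ext; simp
  · rw [Nat.cast_eq_zero, Finset.card_eq_zero, Finset.filter_eq_empty_iff]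
    rintro x - rfl
    exact hs (col_card x)

lemma sum_equiv_col (Φ : (Fin w → P) → ℚ) :
    ∑ x : (Σ p, Fin (n p)) ≃ Fin w, Φ (fun j => (x.symm j).1)
      = (∏ p, ((n p).factorial : ℚ)) * ∑ e : Fin w → P,
        if (∀ p, (Finset.univ.filter (fun j => e j = p)).card = n p) then Φ e else 0 := by
  rw [← Finset.sum_fiberwise (s := Finset.univ)
    (g := fun x : (Σ p, Fin (n p)) ≃ Fin w => (fun j => (x.symm j).1)), Finset.mul_sum]
  refine Finset.sum_congr rfl fun e _ => ?_
  have : ∀ x ∈ Finset.univ.filter (fun x : (Σ p, Fin (n p)) ≃ Fin w =>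
        (fun j => (x.symm j).1) = e), Φ (fun j => (x.symm j).1) = Φ e := by
    intro x hx
    simp only [Finset.mem_filter, Finset.mem_univ, true_and] at hx
    rw [hx]
  rw [Finset.sum_congr rfl this, Finset.sum_const, nsmul_eq_mul, equiv_count]
  split_ifs <;> simp
end blk

lemma cycM_conj {n : ℕ} (x g : Equiv.Perm (Fin n)) : cycM (x * g * x⁻¹) = cycM g := by
  simp [cycM, Equiv.Perm.cycleType_conj]

lemma frob {H G : Type*} [Fintype H] [Fintype G] [Group G] (ι : H → G) (φ : H → ℚ) (f : G → ℚ)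
    (hf : ∀ x g, f (x * g * x⁻¹) = f g) :
    sp f (IndFun ι φ) = (Fintype.card H : ℚ)⁻¹ * ∑ h, f (ι h)⁻¹ * φ h := by
  unfold sp IndFun
  have h1 : ∀ x : G, ∀ h : H,
      ∑ g : G, f g * (if ι h = x * g⁻¹ * x⁻¹ then φ h else 0) = f (ι h)⁻¹ * φ h := by
    intro x h
    rw [Finset.sum_eq_single (x⁻¹ * (ι h)⁻¹ * x)]
    · rw [if_pos (by group)]
      congr 1
      simpa using hf x⁻¹ (ι h)⁻¹
    · intro g _ hg
      rw [if_neg, mul_zero]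
      intro h2
      apply hg
      rw [h2]; group
    · simp
  have h2 : ∑ g : G, f g * ((Fintype.card H : ℚ)⁻¹ * ∑ x : G, ∑ h : H,
      if ι h = x * g⁻¹ * x⁻¹ then φ h else 0)
      = (Fintype.card H : ℚ)⁻¹ * ∑ x : G, ∑ h : H, ∑ g : G,
        f g * (if ι h = x * g⁻¹ * x⁻¹ then φ h else 0) := by
    simp only [Finset.mul_sum]
    rw [Finset.sum_comm]
    refine Finset.sum_congr rfl fun x _ => ?_
    rw [Finset.sum_comm]
    refine Finset.sum_congr rfl fun h _ => ?_
    refine Finset.sum_congr rfl fun g _ => ?_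
    ring
  rw [h2]
  simp only [h1, Finset.sum_const, Finset.card_univ, nsmul_eq_mul]
  have : (Fintype.card G : ℚ) ≠ 0 := by exact_mod_cast Fintype.card_ne_zero
  field_simp

lemma pairCF_eval {η : Type*} [Fintype η] (F : Multiset ℕ → ℚ) (a : ℕ) (ns : η → ℕ)
    (gs : ∀ i, Equiv.Perm (Fin (ns i)) → ℚ) :
    pairCF (fun g : Equiv.Perm (Fin a) => F (cycM g)) (multiProdCF ns rfl gs)
      = if a = ∑ i, ns i then (∏ i, ((ns i).factorial : ℚ))⁻¹ *
          ∑ h : (∀ i, Equiv.Perm (Fin (ns i))), F (∑ i, cycM (h i)) * ∏ i, gs i (h i) else 0 := by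
  unfold pairCF
  split_ifs with h
  · subst h
    have h0 : (fun σ => multiProdCF ns rfl gs ((finCongr rfl).permCongr σ))
        = multiProdCF ns rfl gs := by
      funext σ; congr 1
    rw [h0]
    unfold multiProdCF
    rw [frob _ _ _ (fun x g => by rw [cycM_conj])]
    simp only [Fintype.card_pi, Fintype.card_perm, Fintype.card_fin, Nat.cast_prod, cycM_inv]
    congr 1
    refine Finset.sum_congr rfl fun k _ => ?_
    have := cycM_blk (embSigma ns rfl) k
    rw [← this]; rfl
  · rfl

lemma zMult_ne {n : ℕ} (nu : Nat.Partition n) : (zMult nu.parts : ℚ) ≠ 0 := by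
  intro h
  have := class_cardQ nu
  rw [h, mul_zero] at this
  exact Nat.factorial_ne_zero n (by exact_mod_cast this.symm)

lemma pairCF_class {η : Type*} [Fintype η] (F : Multiset ℕ → ℚ) (a : ℕ) (nu : η → PttAll)
    (κ : η → ℚ) :
    pairCF (fun g : Equiv.Perm (Fin a) => F (cycM g))
      (multiProdCF (fun i => (nu i).1) rfl
        (fun i g => if cycM g = (nu i).2.parts then κ i else 0))
      = if a = ∑ i, (nu i).1 then F (∑ i, (nu i).2.parts) *
          ∏ i, (κ i * (zMult (nu i).2.parts : ℚ)⁻¹) else 0 := by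
  rw [pairCF_eval]
  refine if_congr Iff.rfl ?_ rfl
  have h1 : ∀ h : (∀ i, Equiv.Perm (Fin (nu i).1)),
      F (∑ i, cycM (h i)) * ∏ i, (if cycM (h i) = (nu i).2.parts then κ i else 0)
      = F (∑ i, (nu i).2.parts) * ∏ i, (if cycM (h i) = (nu i).2.parts then κ i else 0) := by
    intro h
    by_cases hh : ∀ i, cycM (h i) = (nu i).2.parts
    · simp only [hh]
    · push Not at hh
      obtain ⟨i, hi⟩ := hh
      rw [Finset.prod_eq_zero (Finset.mem_univ i) (by rw [if_neg hi])]
      simp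
  simp only [h1]
  have h4 := Finset.prod_univ_sum (fun i => (Finset.univ : Finset (Equiv.Perm (Fin (nu i).1))))
    (fun i g => if cycM g = (nu i).2.parts then κ i else 0)
  rw [Fintype.piFinset_univ] at h4
  rw [← Finset.mul_sum, ← h4, mul_left_comm,
    ← Finset.prod_inv_distrib, ← Finset.prod_mul_distrib]
  congr 1
  refine Finset.prod_congr rfl fun i _ => ?_
  rw [← Finset.sum_filter, Finset.sum_const, nsmul_eq_mul, ← class_cardQ (nu i).2]
  have h2 := zMult_ne (nu i).2
  have h3 : ((Finset.univ.filter (fun g : Equiv.Perm (Fin (nu i).1) =>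
      cycM g = (nu i).2.parts)).card : ℚ) ≠ 0 := by
    intro h
    have := class_cardQ (nu i).2
    rw [h, zero_mul] at this
    exact Nat.factorial_ne_zero _ (by exact_mod_cast this.symm)
  field_simp

/-! the wreath product -/

section wr
set_option linter.unusedSectionVars false
variable {G : Type*} [Group G] {w : ℕ}

lemma Wr.mul_fst (a b : Wr G w) (i) : (a * b).1 i = a.1 i * b.1 (a.2⁻¹ i) := rfl
lemma Wr.mul_snd (a b : Wr G w) : (a * b).2 = a.2 * b.2 := rfl
lemma Wr.inv_fst (a : Wr G w) (i) : (a⁻¹).1 i = (a.1 (a.2 i))⁻¹ := rfl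
lemma Wr.inv_snd (a : Wr G w) : (a⁻¹).2 = a.2⁻¹ := rfl

lemma Wr.pow_snd (g : Wr G w) (k : ℕ) : (g ^ k).2 = g.2 ^ k := by
  induction k with
  | zero => rfl
  | succ k ih => rw [pow_succ, pow_succ, Wr.mul_snd, ih]

lemma Wr.pow_fst (g : Wr G w) (k : ℕ) (i) : (g ^ k).1 i =
    ((List.range k).map (fun j => g.1 ((g.2⁻¹ ^ j) i))).prod := by
  induction k with
  | zero => rfl
  | succ k ih =>
    rw [pow_succ, Wr.mul_fst, ih, List.range_succ, List.map_append, List.prod_append, Wr.pow_snd]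
    simp

lemma cycleProd_list (x : Fin w → G) (σ : Equiv.Perm (Fin w)) (i : Fin w) :
    cycleProd x σ i = ((List.range (len σ i)).map (fun k => x ((σ⁻¹ ^ k) i))).prod := by
  unfold cycleProd len
  congr!

lemma cycleProd_pow (g : Wr G w) (i) : cycleProd g.1 g.2 i = (g ^ len g.2 i).1 i := by
  rw [Wr.pow_fst, cycleProd_list]

lemma inv_pow_len (g : Wr G w) (i) : ((g ^ len g.2 i).2)⁻¹ i = i := by
  rw [Wr.pow_snd, Equiv.Perm.inv_eq_iff_eq, pow_len]

lemma cycleProd_conj (X g : Wr G w) (i) :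
    cycleProd (X * g * X⁻¹).1 (X * g * X⁻¹).2 (X.2 i)
      = X.1 (X.2 i) * cycleProd g.1 g.2 i * (X.1 (X.2 i))⁻¹ := by
  have hl : len (X * g * X⁻¹).2 (X.2 i) = len g.2 i :=
    len_intertwine X.2 (fun j => by simp [Wr.mul_snd, Wr.inv_snd]) i
  rw [cycleProd_pow, cycleProd_pow, hl, conj_pow, Wr.mul_fst, Wr.mul_fst, Wr.inv_fst,
    Wr.mul_snd]
  have h1 : X.2⁻¹ (X.2 i) = i := by simp
  have h2 : (X.2 * (g ^ len g.2 i).2)⁻¹ (X.2 i) = i := by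
    rw [mul_inv_rev, Equiv.Perm.mul_apply, h1, inv_pow_len]
  rw [h1, h2]

lemma cycleProd_self (g : Wr G w) (i) :
    cycleProd g.1 g.2 (g.2 i) = g.1 (g.2 i) * cycleProd g.1 g.2 i * (g.1 (g.2 i))⁻¹ := by
  have := cycleProd_conj g g i
  rwa [mul_inv_cancel_right] at this

lemma cycleProd_inv (g : Wr G w) (i) :
    cycleProd (g⁻¹).1 (g⁻¹).2 i = (cycleProd g.1 g.2 i)⁻¹ := by
  rw [cycleProd_pow, cycleProd_pow, Wr.inv_snd, len_inv, inv_pow, Wr.inv_fst]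
  congr 2
  rw [← Equiv.Perm.inv_eq_iff_eq.1 (inv_pow_len g i)]

lemma cycleProd_embWr {η : Type*} [Fintype η] (ws : η → ℕ)
    (h : ∑ i, ws i = w) (k : ∀ i, Wr G (ws i)) (t) (i) :
    cycleProd (embWr ws h k).1 (embWr ws h k).2 (embSigma ws h ⟨t, i⟩)
      = cycleProd (k t).1 (k t).2 i := by
  have hs : (embWr ws h k).2 = blk (embSigma ws h) (fun t => (k t).2) := rfl
  have hl := len_blk (embSigma ws h) (fun t => (k t).2) t i
  rw [hs]
  rw [cycleProd_list, cycleProd_list, hl]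
  congr 2
  funext j
  have h2 := zpow_intertwine (embSigma ws h)
    (blk_comm (embSigma ws h) (fun t => (k t).2)) (-(j : ℤ)) ⟨t, i⟩
  rw [sigma_zpow] at h2
  simp only [zpow_neg, zpow_natCast, ← inv_pow] at h2
  rw [← h2]
  simp only [embWr]
  rw [Equiv.symm_apply_apply]

/-- weight of a colouring -/
def Fc {T : Type*} [Fintype T] (φ : T → G → ℚ) (f : T → Multiset ℕ → ℚ) (g : Wr G w)
    (c : Fin w → T) : ℚ :=
  (∏ t, f t (Tc g.2 c t)) * ∏ b ∈ basepoints g.2, φ (c b) (cycleProd g.1 g.2 b)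

variable {T : Type*} [Fintype T] (φ : T → G → ℚ) (f : T → Multiset ℕ → ℚ)

lemma Fc_inv_aux (hφ : ∀ t, ∀ x g : G, φ t (x * g * x⁻¹) = φ t g)
    (g : Wr G w) (c : Fin w → T) (hc : ∀ j, c (g.2 j) = c j) (i) :
    φ (c (g.2 i)) (cycleProd g.1 g.2 (g.2 i)) = φ (c i) (cycleProd g.1 g.2 i) := by
  rw [cycleProd_self, hφ, hc]

lemma Fc_emb (hφ : ∀ t, ∀ x g : G, φ t (x * g * x⁻¹) = φ t g)
    (ws : T → ℕ) (h : ∑ i, ws i = w) (k : ∀ i, Wr G (ws i)) :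
    Fc φ f (embWr ws h k) (fun j => ((embSigma ws h).symm j).1)
      = ∏ t, tilprod (φ t) (k t) * f t (cycM (k t).2) := by
  have hs : (embWr ws h k).2 = blk (embSigma ws h) (fun t => (k t).2) := rfl
  have h1 := Fc_inv_aux φ hφ (embWr ws h k) (fun j => ((embSigma ws h).symm j).1)
    (fun j => blk_col (embSigma ws h) (fun t => (k t).2) j)
  unfold Fc tilprod
  rw [Finset.prod_mul_distrib, mul_comm]
  congr 1
  · have h2 := blk_prod (embSigma ws h) (fun t => (k t).2) (fun i => φ ((embSigma ws h).symm i).1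
      (cycleProd (embWr ws h k).1 (embWr ws h k).2 i)) h1
    refine h2.trans ?_
    simp only [cycleProd_embWr, Equiv.symm_apply_apply]
  · simp only [hs, Tc_blk]

lemma embWr_inj (ws : T → ℕ) (h : ∑ i, ws i = w) :
    Function.Injective (embWr (G := G) ws h) := by
  intro k k' hk
  have h2 : (fun t => (k t).2) = (fun t => (k' t).2) :=
    blk_inj (embSigma ws h) (congrArg Prod.snd hk)
  funext t
  refine Prod.ext ?_ (congrFun h2 t)
  funext i
  have h3 : ∀ k : ∀ i, Wr G (ws i), (embWr ws h k).1 (embSigma ws h ⟨t, i⟩) = (k t).1 i := by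
    intro k
    simp only [embWr]
    rw [Equiv.symm_apply_apply]
  rw [← h3, ← h3, hk]

lemma embWr_surj (ws : T → ℕ) (h : ∑ i, ws i = w) (g : Wr G w)
    (hg : ∀ j, ((embSigma ws h).symm (g.2 j)).1 = ((embSigma ws h).symm j).1) :
    ∃ k, embWr ws h k = g := by
  obtain ⟨τ, hτ⟩ := blk_surj (embSigma ws h) g.2 hg
  refine ⟨fun t => (fun i => g.1 (embSigma ws h ⟨t, i⟩), τ t), ?_⟩
  refine Prod.ext ?_ hτ
  funext j
  simp [embWr]

variable [Fintype G]

lemma sum_embWr (hφ : ∀ t, ∀ x g : G, φ t (x * g * x⁻¹) = φ t g)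
    (ws : T → ℕ) (h : ∑ i, ws i = w) (g : Wr G w) :
    (∑ k : (∀ i, Wr G (ws i)), if embWr ws h k = g then
        ∏ t, tilprod (φ t) (k t) * f t (cycM (k t).2) else 0)
      = if ∀ j, ((embSigma ws h).symm (g.2 j)).1 = ((embSigma ws h).symm j).1 then
          Fc φ f g (fun j => ((embSigma ws h).symm j).1) else 0 := by
  split_ifs with hg
  · obtain ⟨k, rfl⟩ := embWr_surj ws h g hg
    rw [Finset.sum_eq_single k]
    · rw [if_pos rfl, Fc_emb φ f hφ]
    · intro k' _ hk; rw [if_neg fun hh => hk (embWr_inj ws h hh)]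
    · simp
  · refine Finset.sum_eq_zero fun k _ => ?_
    rw [if_neg]
    rintro rfl
    exact hg fun j => blk_col (embSigma ws h) (fun t => (k t).2) j

lemma Tc_conj (τ σ : Equiv.Perm (Fin w)) (c : Fin w → T)
    (hc : ∀ j, c ((τ * σ * τ⁻¹) j) = c j) (t) :
    Tc (τ * σ * τ⁻¹) c t = Tc σ (fun j => c (τ j)) t := by
  have hi : ∀ j, τ (σ j) = (τ * σ * τ⁻¹) (τ j) := fun j => by simp
  unfold Tc
  rw [sum_tr (basepoints_isTr _) ((basepoints_isTr σ).map τ hi), Finset.sum_map]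
  · refine Finset.sum_congr rfl fun b _ => ?_
    have := len_intertwine τ hi b
    simp only [Equiv.coe_toEmbedding, this]
  · intro i; rw [hc, len_same]

lemma Fc_conj (hφ : ∀ t, ∀ x g : G, φ t (x * g * x⁻¹) = φ t g)
    (X g : Wr G w) (c : Fin w → T)
    (hc : ∀ j, c ((X * g * X⁻¹).2 j) = c j) :
    Fc φ f (X * g * X⁻¹) c = Fc φ f g (fun j => c (X.2 j)) := by
  have hi : ∀ j, X.2 (g.2 j) = (X * g * X⁻¹).2 (X.2 j) :=
    fun j => by simp [Wr.mul_snd, Wr.inv_snd]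
  unfold Fc
  congr 1
  · refine Finset.prod_congr rfl fun t _ => ?_
    rw [← Tc_conj X.2 g.2 c hc]; rfl
  · rw [prod_tr (basepoints_isTr _) ((basepoints_isTr g.2).map X.2 hi) _
      (Fc_inv_aux φ hφ _ c hc), Finset.prod_map]
    refine Finset.prod_congr rfl fun b _ => ?_
    simp only [Equiv.coe_toEmbedding, cycleProd_conj, hφ]

lemma Wr.card : Fintype.card (Wr G w) = Fintype.card G ^ w * w.factorial := by
  have : Fintype.card (Wr G w) = Fintype.card ((Fin w → G) × Equiv.Perm (Fin w)) := rfl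
  rw [this, Fintype.card_prod]
  simp [Fintype.card_perm]

lemma Wr.sum (F : Wr G w → ℚ) : ∑ g, F g = ∑ σ : Equiv.Perm (Fin w), ∑ x : Fin w → G, F (x, σ) :=
  Fintype.sum_prod_type_right (f := F)

lemma zeta_col (hφ : ∀ t, ∀ x g : G, φ t (x * g * x⁻¹) = φ t g)
    (ws : T → ℕ) (h : ∑ i, ws i = w) (g : Wr G w) :
    zetaTuple ws h φ (fun t σ => f t (cycM σ)) g
      = ∑ c : Fin w → T, if (∀ t, (Finset.univ.filter (fun j => c j = t)).card = ws t) then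
          (if ∀ j, c (g.2 j) = c j then Fc φ f g c else 0) else 0 := by
  unfold zetaTuple IndFun
  simp only [sum_embWr φ f hφ]
  set x0 := embSigma ws h with hx0
  have h1 : ∀ X : Wr G w,
      (if ∀ j, (x0.symm ((X * g * X⁻¹).2 j)).1 = (x0.symm j).1 then
        Fc φ f (X * g * X⁻¹) (fun j => (x0.symm j).1) else 0)
      = (fun c : Fin w → T => if ∀ j, c (g.2 j) = c j then Fc φ f g c else 0)
        (fun j => (x0.symm (X.2 j)).1) := by
    intro X
    have hiff : (∀ j, (x0.symm ((X * g * X⁻¹).2 j)).1 = (x0.symm j).1) ↔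
        ∀ j, (x0.symm (X.2 (g.2 j))).1 = (x0.symm (X.2 j)).1 := by
      constructor
      · intro hh j
        have := hh (X.2 j)
        simpa [Wr.mul_snd, Wr.inv_snd] using this
      · intro hh j
        have := hh (X.2⁻¹ j)
        simpa [Wr.mul_snd, Wr.inv_snd] using this
    by_cases hh : ∀ j, (x0.symm ((X * g * X⁻¹).2 j)).1 = (x0.symm j).1
    · rw [if_pos hh, Fc_conj φ f hφ _ _ _ hh]
      simp only
      rw [if_pos (hiff.1 hh)]
    · rw [if_neg hh]
      simp only
      rw [if_neg (mt hiff.2 hh)]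
  simp only [h1]
  rw [Wr.sum]
  simp only [Finset.sum_const, Finset.card_univ, ← Finset.smul_sum]
  set Φ := (fun c : Fin w → T => if ∀ j, c (g.2 j) = c j then Fc φ f g c else 0) with hΦ
  have h2 : ∑ σ : Equiv.Perm (Fin w), Φ (fun j => (x0.symm (σ j)).1)
      = ∑ x : (Σ t, Fin (ws t)) ≃ Fin w, Φ (fun j => (x.symm j).1) := by
    refine Finset.sum_bij' (fun σ _ => x0.trans σ.symm) (fun x _ => x.symm.trans x0) ?_ ?_ ?_ ?_ ?_
    · simp
    · simp
    · intro x _; ext; simp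
    · intro x _; ext; simp
    · intro σ _; simp
  have h3 := h2.trans (sum_equiv_col (n := ws) Φ)
  have h4 : (Fintype.card (∀ t, Wr G (ws t)) : ℚ)
      = (Fintype.card G : ℚ) ^ w * ∏ t, ((ws t).factorial : ℚ) := by
    rw [Fintype.card_pi]
    simp only [Wr.card]
    rw [Finset.prod_mul_distrib, Finset.prod_pow_eq_pow_sum, h]
    push_cast; rfl
  have h5 : (Fintype.card G : ℚ) ≠ 0 := by exact_mod_cast Fintype.card_ne_zero
  have h6 : ∏ t, ((ws t).factorial : ℚ) ≠ 0 :=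
    Finset.prod_ne_zero_iff.2 fun t _ => by exact_mod_cast Nat.factorial_ne_zero _
  rw [h4, nsmul_eq_mul]
  simp only [Fintype.card_fun, Fintype.card_fin, Nat.cast_pow]
  refine (congrArg (fun z => _ * (_ * z)) h3).trans ?_
  field_simp
  rfl
end wr

lemma integ_inj {G : Type*} [Group G] {w : ℕ} (σ : Equiv.Perm (Fin w)) :
    Function.Injective (fun (x : Fin w → G) (i : Fin w) =>
      if i ∈ basepoints σ then cycleProd x σ i else x i) := by
  intro x x' hx
  have h0 : ∀ i, i ∉ basepoints σ → x i = x' i := by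
    intro i hi
    have := congrFun hx i
    simpa [hi] using this
  funext i
  by_cases hi : i ∈ basepoints σ
  · have h1 := congrFun hx i
    simp only [hi, if_true] at h1
    rw [cycleProd_list, cycleProd_list] at h1
    obtain ⟨m, hm⟩ : ∃ m, len σ i = m + 1 := ⟨len σ i - 1, by have := len_pos σ i; omega⟩
    rw [hm, List.prod_range_succ', List.prod_range_succ'] at h1
    have h2 : (List.range m).map (fun k => x ((σ⁻¹ ^ (k + 1)) i))
        = (List.range m).map (fun k => x' ((σ⁻¹ ^ (k + 1)) i)) := by
      apply List.map_congr_left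
      intro k hk
      rw [List.mem_range] at hk
      apply h0
      intro hb
      have hs : σ.SameCycle i ((σ⁻¹ ^ (k + 1)) i) :=
        ⟨-((k + 1 : ℕ) : ℤ), by rw [zpow_neg, zpow_natCast, inv_pow]⟩
      have h3 := (basepoints_isTr σ i).unique ⟨hi, Equiv.Perm.SameCycle.refl _ _⟩ ⟨hb, hs⟩
      have h4 : (σ ^ (k + 1)) i = i := by
        rw [inv_pow] at h3
        exact (Equiv.Perm.eq_inv_iff_eq.1 h3)
      have h5 := Nat.le_of_dvd (by omega) ((pow_eq_len σ i (k + 1)).1 h4)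
      omega
    rw [h2] at h1
    simpa using h1
  · exact h0 i hi

lemma integ {G : Type*} [Group G] [Fintype G] {w : ℕ} (σ : Equiv.Perm (Fin w))
    (F : Fin w → G → ℚ) :
    ∑ x : Fin w → G, ∏ b ∈ basepoints σ, F b (cycleProd x σ b)
      = (Fintype.card G : ℚ) ^ w *
        ∏ b ∈ basepoints σ, ((Fintype.card G : ℚ)⁻¹ * ∑ g, F b g) := by
  have hG : (Fintype.card G : ℚ) ≠ 0 := by exact_mod_cast Fintype.card_ne_zero
  set Y := (fun (x : Fin w → G) (i : Fin w) =>
      if i ∈ basepoints σ then cycleProd x σ i else x i) with hY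
  have hbij : Function.Bijective Y := Finite.injective_iff_bijective.1 (integ_inj σ)
  have h1 : ∑ x : Fin w → G, ∏ b ∈ basepoints σ, F b (cycleProd x σ b)
      = ∑ x : Fin w → G, (fun y : Fin w → G => ∏ b ∈ basepoints σ, F b (y b)) (Y x) := by
    refine Finset.sum_congr rfl fun x _ => Finset.prod_congr rfl fun b hb => ?_
    simp [hY, hb]
  refine (h1.trans (hbij.sum_comp (fun y : Fin w → G => ∏ b ∈ basepoints σ, F b (y b)))).trans ?_
  have h2 : ∀ y : Fin w → G, ∏ b ∈ basepoints σ, F b (y b)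
      = ∏ i, (if i ∈ basepoints σ then F i (y i) else 1) := by
    intro y
    rw [Finset.prod_ite_mem, Finset.univ_inter]
  simp only [h2]
  have h4 := Finset.prod_univ_sum (fun _ : Fin w => (Finset.univ : Finset G))
    (fun i g => if i ∈ basepoints σ then F i g else 1)
  rw [Fintype.piFinset_univ] at h4
  rw [← h4]
  have h5 : ∀ i : Fin w, ∑ g : G, (if i ∈ basepoints σ then F i g else 1)
      = (Fintype.card G : ℚ) * (if i ∈ basepoints σ then
          (Fintype.card G : ℚ)⁻¹ * ∑ g, F i g else 1) := by
    intro i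
    split_ifs with hi
    · field_simp
    · simp
  simp only [h5]
  rw [Finset.prod_mul_distrib, Finset.prod_ite_mem, Finset.univ_inter]
  simp

section count
set_option linter.unusedSectionVars false
variable {P : Type*} [Fintype P] {w : ℕ}

lemma Tc_sum (σ : Equiv.Perm (Fin w)) (e : Fin w → P) (he : ∀ j, e (σ j) = e j) (p) :
    (Tc σ e p).sum = (Finset.univ.filter (fun j => e j = p)).card := by
  have h1 := equiv_count (n := fun p => (Finset.univ.filter (fun j => e j = p)).card) e
  rw [if_pos (fun _ => rfl)] at h1
  have h2 : (Finset.univ.filter (fun x : (Σ p, Fin ((Finset.univ.filter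
      (fun j => e j = p)).card)) ≃ Fin w => (fun j => (x.symm j).1) = e)).Nonempty := by
    rw [← Finset.card_pos, Nat.pos_iff_ne_zero]
    intro h0
    rw [h0] at h1
    have : ∏ p, (((Finset.univ.filter (fun j => e j = p)).card.factorial : ℕ) : ℚ) ≠ 0 :=
      Finset.prod_ne_zero_iff.2 fun t _ => by exact_mod_cast Nat.factorial_ne_zero _
    exact this (by exact_mod_cast h1.symm)
  obtain ⟨x, hx⟩ := h2
  simp only [Finset.mem_filter, Finset.mem_univ, true_and] at hx
  obtain ⟨h, rfl⟩ := blk_surj x σ (by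
    intro j
    have h3 := he j
    rw [← congrFun hx j, ← congrFun hx (σ j)] at h3
    exact h3)
  have h4 := Tc_blk x h p
  rw [hx] at h4
  rw [h4, cycM_sum]

lemma Tc_total (σ : Equiv.Perm (Fin w)) (e : Fin w → P) (he : ∀ j, e (σ j) = e j) :
    ∑ p, (Tc σ e p).sum = w := by
  simp only [Tc_sum σ e he]
  have := Finset.card_eq_sum_card_fiberwise (s := (Finset.univ : Finset (Fin w)))
    (t := (Finset.univ : Finset P)) (f := e) (fun _ _ => Finset.mem_univ _)
  rw [← this]
  simp

lemma ptt_ext {a b : PttAll} (h : a.2.parts = b.2.parts) : a = b := by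
  obtain ⟨n, a⟩ := a
  obtain ⟨m, b⟩ := b
  obtain rfl : n = m := by
    rw [← a.parts_sum, ← b.parts_sum]; exact congrArg Multiset.sum h
  congr 1
  exact Nat.Partition.ext h

lemma Tc_exists (σ : Equiv.Perm (Fin w)) (e : Fin w → P) :
    ∃ nu : P → PttAll, ∀ p, Tc σ e p = (nu p).2.parts := by
  refine ⟨fun p => ⟨(Tc σ e p).sum, ⟨Tc σ e p, ?_, rfl⟩⟩, fun p => rfl⟩
  intro i hi
  unfold Tc at hi
  rw [Multiset.mem_sum] at hi
  obtain ⟨b, -, hb⟩ := hi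
  split_ifs at hb with h
  · rw [Multiset.mem_singleton] at hb
    rw [hb]; exact len_pos _ _
  · simp at hb

lemma count_nu (nu : P → PttAll) (hw : ∑ p, (nu p).1 = w) :
    ∑ σ : Equiv.Perm (Fin w), ∑ e : Fin w → P,
      (if ∀ j, e (σ j) = e j then (if ∀ p, Tc σ e p = (nu p).2.parts then (1 : ℚ) else 0) else 0)
      = w.factorial * ∏ p, (zMult (nu p).2.parts : ℚ)⁻¹ := by
  rw [Finset.sum_comm]
  set Φ : (Fin w → P) → ℚ := fun e => ∑ σ : Equiv.Perm (Fin w),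
    (if ∀ j, e (σ j) = e j then (if ∀ p, Tc σ e p = (nu p).2.parts then (1 : ℚ) else 0) else 0)
    with hΦ
  have h6 : ∏ p, (((nu p).1.factorial : ℕ) : ℚ) ≠ 0 :=
    Finset.prod_ne_zero_iff.2 fun t _ => by exact_mod_cast Nat.factorial_ne_zero _
  have h1 : ∀ e, (if (∀ p, (Finset.univ.filter (fun j => e j = p)).card = (nu p).1) then
      Φ e else 0) = Φ e := by
    intro e
    split_ifs with hs
    · rfl
    · symm
      apply Finset.sum_eq_zero
      intro σ _
      split_ifs with ha hb
      · exfalso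
        apply hs
        intro p
        rw [← Tc_sum σ e ha, hb, (nu p).2.parts_sum]
      · rfl
      · rfl
  have h2 := sum_equiv_col (n := fun p => (nu p).1) Φ
  simp only [h1] at h2
  have h3 : ∀ x : (Σ p, Fin (nu p).1) ≃ Fin w, Φ (fun j => (x.symm j).1)
      = ∏ p, ((nu p).1.factorial * (zMult (nu p).2.parts : ℚ)⁻¹) := by
    intro x
    have h4 := sum_blk x (fun σ => if ∀ p, Tc σ (fun j => (x.symm j).1) p = (nu p).2.parts
      then (1 : ℚ) else 0)
    refine h4.trans ?_
    simp only [Tc_blk]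
    have h5 := Finset.prod_univ_sum
      (fun i => (Finset.univ : Finset (Equiv.Perm (Fin (nu i).1))))
      (fun i g => if cycM g = (nu i).2.parts then (1 : ℚ) else 0)
    rw [Fintype.piFinset_univ] at h5
    have h7 : ∀ h : (∀ p, Equiv.Perm (Fin (nu p).1)),
        (if ∀ p, cycM (h p) = (nu p).2.parts then (1 : ℚ) else 0)
        = ∏ p, if cycM (h p) = (nu p).2.parts then (1 : ℚ) else 0 := by
      intro h
      split_ifs with hh
      · simp [hh]
      · push Not at hh
        obtain ⟨p, hp⟩ := hh
        rw [Finset.prod_eq_zero (Finset.mem_univ p) (by rw [if_neg hp])]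
    simp only [h7]
    rw [← h5]
    refine Finset.prod_congr rfl fun p _ => ?_
    rw [← Finset.sum_filter, Finset.sum_const, nsmul_eq_mul, mul_one, ← class_cardQ,
      mul_inv_cancel_right₀ (zMult_ne _)]
  simp only [h3, Finset.sum_const, Finset.card_univ, nsmul_eq_mul] at h2
  rw [Fintype.card_equiv (embSigma (fun p => (nu p).1) hw), Finset.prod_mul_distrib] at h2
  have hc : Fintype.card (Σ p, Fin (nu p).1) = w := by simp [hw]
  rw [hc, mul_left_comm] at h2
  exact (mul_left_cancel₀ h6 h2).symm

lemma finite_S (P : Type*) [Fintype P] (w : ℕ) :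
    {nu : P → PttAll | ∑ p, (nu p).1 = w}.Finite := by
  have h1 : {x : PttAll | x.1 ≤ w}.Finite := by
    refine (((Finset.range (w + 1)).sigma
      (fun n => (Finset.univ : Finset (Nat.Partition n)))).finite_toSet).subset ?_
    rintro ⟨n, a⟩ h
    simp only [Set.mem_ofPred_eq] at h
    simp; omega
  refine (Set.Finite.pi' (fun _ : P => h1)).subset ?_
  intro nu h p
  simp only [Set.mem_ofPred_eq] at h ⊢
  rw [← h]
  exact Finset.single_le_sum (f := fun p => (nu p).1) (fun _ _ => Nat.zero_le _)
    (Finset.mem_univ p)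

lemma count_main (R : (P → Multiset ℕ) → ℚ)
    (hR : ∀ nu : P → PttAll, R (fun p => (nu p).2.parts) ≠ 0 → ∑ p, (nu p).1 = w) :
    (w.factorial : ℚ)⁻¹ * ∑ σ : Equiv.Perm (Fin w), ∑ e : Fin w → P,
      (if ∀ j, e (σ j) = e j then R (Tc σ e) else 0)
    = ∑ᶠ nu : P → PttAll, R (fun p => (nu p).2.parts) * ∏ p, (zMult (nu p).2.parts : ℚ)⁻¹ := by
  have hS := finite_S P w
  rw [finsum_eq_sum_of_support_subset (s := hS.toFinset)]
  swap
  · intro nu hnu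
    simp only [Set.Finite.coe_toFinset, Set.mem_ofPred_eq]
    exact hR nu (left_ne_zero_of_mul hnu)
  have h1 : ∀ (σ : Equiv.Perm (Fin w)) (e : Fin w → P),
      (if ∀ j, e (σ j) = e j then R (Tc σ e) else 0)
      = ∑ nu ∈ hS.toFinset, R (fun p => (nu p).2.parts) *
        (if ∀ j, e (σ j) = e j then (if ∀ p, Tc σ e p = (nu p).2.parts then (1 : ℚ) else 0)
          else 0) := by
    intro σ e
    split_ifs with he
    · obtain ⟨nu, hnu⟩ := Tc_exists σ e
      rw [Finset.sum_eq_single nu]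
      · rw [if_pos hnu, mul_one]
        congr 1
        funext p; exact hnu p
      · intro nu' _ hne
        rw [if_neg, mul_zero]
        intro h
        apply hne
        funext p
        exact ptt_ext ((h p).symm.trans (hnu p))
      · intro h
        exfalso
        apply h
        rw [Set.Finite.mem_toFinset, Set.mem_ofPred_eq]
        have := Tc_total σ e he
        simp only [hnu, Nat.Partition.parts_sum] at this
        exact this
    · simp
  simp only [h1]
  have h2 : ∀ nu ∈ hS.toFinset, R (fun p => (nu p).2.parts) *
      ∏ p, (zMult (nu p).2.parts : ℚ)⁻¹ = (w.factorial : ℚ)⁻¹ * ∑ σ : Equiv.Perm (Fin w),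
        ∑ e : Fin w → P, R (fun p => (nu p).2.parts) *
        (if ∀ j, e (σ j) = e j then (if ∀ p, Tc σ e p = (nu p).2.parts then (1 : ℚ) else 0)
          else 0) := by
    intro nu hnu
    rw [Set.Finite.mem_toFinset, Set.mem_ofPred_eq] at hnu
    simp only [← Finset.mul_sum]
    rw [count_nu nu hnu]
    have : (w.factorial : ℚ) ≠ 0 := by exact_mod_cast Nat.factorial_ne_zero _
    field_simp
  rw [Finset.sum_congr rfl h2, ← Finset.mul_sum]
  congr 1
  exact (Finset.sum_congr rfl fun σ _ => Finset.sum_comm).trans Finset.sum_comm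
end count

section final
set_option linter.unusedSectionVars false
variable {T Q : Type*} [Fintype T] [Fintype Q]

/-- The contribution of a family of cycle types. -/
def Rw (f : T → Multiset ℕ → ℚ) (h : Q → Multiset ℕ → ℚ) (A : T → Q → ℚ) (a : T → ℕ) (b : Q → ℕ)
    (nu : T × Q → Multiset ℕ) : ℚ :=
  if (∀ t, a t = ∑ q, (nu (t, q)).sum) ∧ (∀ q, b q = ∑ t, (nu (t, q)).sum) then
    (∏ t, f t (∑ q, nu (t, q))) * (∏ q, h q (∑ t, nu (t, q))) *
      ∏ t, ∏ q, A t q ^ Multiset.card (nu (t, q)) else 0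

lemma prod_ite_all {ι : Type*} [Fintype ι] (p : ι → Prop) [DecidablePred p]
    [Decidable (∀ i, p i)] (X : ι → ℚ) :
    ∏ i, (if p i then X i else 0) = if ∀ i, p i then ∏ i, X i else 0 := by
  split_ifs with h
  · simp [h]
  · push Not at h
    obtain ⟨i, hi⟩ := h
    exact Finset.prod_eq_zero (Finset.mem_univ i) (by rw [if_neg hi])

lemma wr_term (A : T → Q → ℚ) (lam : T → PttAll) (mu : Q → PttAll) (nu : T × Q → PttAll) :
    (∏ t : T, pairCF (sFun (lam t).2)
        (multiProdCF (fun q => (nu (t, q)).1) rfl (fun q => ptFun (nu (t, q)).2))) *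
    (∏ q : Q, pairCF (sFun (mu q).2)
        (multiProdCF (fun t => (nu (t, q)).1) rfl (fun t => pFun (nu (t, q)).2))) *
    (∏ t : T, ∏ q : Q, A t q ^ (Multiset.card (nu (t, q)).2.parts))
    = Rw (fun t => sval (lam t).2.parts) (fun q => sval (mu q).2.parts) A
        (fun t => (lam t).1) (fun q => (mu q).1) (fun p => (nu p).2.parts)
      * ∏ p, (zMult (nu p).2.parts : ℚ)⁻¹ := by
  have h1 : ∀ t, pairCF (sFun (lam t).2)
        (multiProdCF (fun q => (nu (t, q)).1) rfl (fun q => ptFun (nu (t, q)).2))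
      = if (lam t).1 = ∑ q, (nu (t, q)).1 then sval (lam t).2.parts (∑ q, (nu (t, q)).2.parts) *
          ∏ q, ((1 : ℚ) * (zMult (nu (t, q)).2.parts : ℚ)⁻¹) else 0 := fun t =>
    pairCF_class (sval (lam t).2.parts) (lam t).1 (fun q => nu (t, q)) (fun _ => 1)
  have h2 : ∀ q, pairCF (sFun (mu q).2)
        (multiProdCF (fun t => (nu (t, q)).1) rfl (fun t => pFun (nu (t, q)).2))
      = if (mu q).1 = ∑ t, (nu (t, q)).1 then sval (mu q).2.parts (∑ t, (nu (t, q)).2.parts) *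
          ∏ t, ((zMult (nu (t, q)).2.parts : ℚ) * (zMult (nu (t, q)).2.parts : ℚ)⁻¹) else 0 :=
    fun q => pairCF_class (sval (mu q).2.parts) (mu q).1 (fun t => nu (t, q))
      (fun t => (zMult (nu (t, q)).2.parts : ℚ))
  simp only [h1, h2, mul_inv_cancel₀ (zMult_ne _), one_mul, Finset.prod_const_one, mul_one]
  rw [prod_ite_all, prod_ite_all]
  unfold Rw
  simp only [Nat.Partition.parts_sum]
  by_cases ha : ∀ t, (lam t).1 = ∑ q, (nu (t, q)).1
  · by_cases hb : ∀ q, (mu q).1 = ∑ t, (nu (t, q)).1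
    · rw [if_pos ha, if_pos hb, if_pos ⟨ha, hb⟩, Finset.prod_mul_distrib, Fintype.prod_prod_type]
      ring
    · rw [if_neg hb, mul_zero, zero_mul]
      symm; convert zero_mul _
      exact if_neg (fun h => hb h.2)
  · rw [if_neg ha, zero_mul, zero_mul]
    symm; convert zero_mul _
    exact if_neg (fun h => ha h.1)

lemma Tc_fst {w : ℕ} (σ : Equiv.Perm (Fin w)) (e : Fin w → T × Q) (t : T) :
    Tc σ (fun j => (e j).1) t = ∑ q, Tc σ e (t, q) := by
  unfold Tc
  rw [Finset.sum_comm]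
  refine Finset.sum_congr rfl fun b _ => ?_
  by_cases h : (e b).1 = t
  · rw [if_pos h, Finset.sum_eq_single (e b).2]
    · rw [if_pos (show e b = (t, (e b).2) from Prod.ext h rfl)]
    · intro q _ hq; rw [if_neg]; intro h2; exact hq (by rw [h2])
    · simp
  · rw [if_neg h]
    symm
    apply Finset.sum_eq_zero
    intro q _; rw [if_neg]; intro h2; exact h (by rw [h2])

lemma Tc_snd {w : ℕ} (σ : Equiv.Perm (Fin w)) (e : Fin w → T × Q) (q : Q) :
    Tc σ (fun j => (e j).2) q = ∑ t, Tc σ e (t, q) := by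
  unfold Tc
  rw [Finset.sum_comm]
  refine Finset.sum_congr rfl fun b _ => ?_
  by_cases h : (e b).2 = q
  · rw [if_pos h, Finset.sum_eq_single (e b).1]
    · rw [if_pos (show e b = ((e b).1, q) from Prod.ext rfl h)]
    · intro q _ hq; rw [if_neg]; intro h2; exact hq (by rw [h2])
    · simp
  · rw [if_neg h]
    symm
    apply Finset.sum_eq_zero
    intro q _; rw [if_neg]; intro h2; exact h (by rw [h2])

lemma Tc_pow {P : Type*} [Fintype P] {w : ℕ} (σ : Equiv.Perm (Fin w)) (e : Fin w → P)
    (A : P → ℚ) :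
    ∏ b ∈ basepoints σ, A (e b) = ∏ p, A p ^ Multiset.card (Tc σ e p) := by
  have h1 : ∀ p, Multiset.card (Tc σ e p)
      = ∑ b ∈ basepoints σ, if e b = p then 1 else 0 := by
    intro p
    unfold Tc
    rw [Multiset.card_sum]
    refine Finset.sum_congr rfl fun b _ => ?_
    split_ifs <;> simp
  simp only [h1, ← Finset.prod_pow_eq_pow_sum]
  rw [Finset.prod_comm]
  refine Finset.prod_congr rfl fun b _ => ?_
  rw [Finset.prod_eq_single (e b)]
  · simp
  · intro p _ hp; rw [if_neg (Ne.symm hp), pow_zero]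
  · simp

variable {G : Type*} [Group G] [Fintype G] {w : ℕ}

lemma Tc_inv {P : Type*} (σ : Equiv.Perm (Fin w)) (c : Fin w → P) (p) :
    Tc σ⁻¹ c p = Tc σ c p := by
  unfold Tc
  simp only [basepoints_inv, len_inv]

lemma Fc_inv (ψ : Q → G → ℚ) (h : Q → Multiset ℕ → ℚ) (g : Wr G w) (d : Fin w → Q) :
    Fc ψ h g⁻¹ d = (∏ q, h q (Tc g.2 d q)) *
      ∏ b ∈ basepoints g.2, ψ (d b) (cycleProd g.1 g.2 b)⁻¹ := by
  unfold Fc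
  simp only [cycleProd_inv]
  simp only [Wr.inv_snd, Tc_inv, basepoints_inv]

/-- The element of the wreath product with given components. -/
def mkWr (x : Fin w → G) (σ : Equiv.Perm (Fin w)) : Wr G w := (x, σ)

lemma mkWr_fst (x : Fin w → G) (σ : Equiv.Perm (Fin w)) : (mkWr x σ).1 = x := rfl

lemma mkWr_snd (x : Fin w → G) (σ : Equiv.Perm (Fin w)) : (mkWr x σ).2 = σ := rfl

lemma sum_mkWr (F : Wr G w → ℚ) :
    ∑ g, F g = ∑ σ : Equiv.Perm (Fin w), ∑ x : Fin w → G, F (mkWr x σ) := Wr.sum F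

lemma sp_def {H : Type*} [Group H] [Fintype H] (f h : H → ℚ) :
    sp f h = (Fintype.card H : ℚ)⁻¹ * ∑ g : H, f g * h g⁻¹ := rfl

lemma Fc_sum (φ : T → G → ℚ) (f : T → Multiset ℕ → ℚ) (ψ : Q → G → ℚ) (h : Q → Multiset ℕ → ℚ)
    (σ : Equiv.Perm (Fin w)) (c : Fin w → T) (d : Fin w → Q) :
    ∑ x : Fin w → G, Fc φ f (mkWr x σ) c * Fc ψ h (mkWr x σ)⁻¹ d
      = (Fintype.card G : ℚ) ^ w * ((∏ t, f t (Tc σ c t)) * (∏ q, h q (Tc σ d q)) *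
        ∏ b ∈ basepoints σ, sp (φ (c b)) (ψ (d b))) := by
  have h1 := integ σ (fun b g => φ (c b) g * ψ (d b) g⁻¹)
  have h2 : ∀ x : Fin w → G, Fc φ f (mkWr x σ) c * Fc ψ h (mkWr x σ)⁻¹ d
      = ((∏ t, f t (Tc σ c t)) * (∏ q, h q (Tc σ d q))) *
        ∏ b ∈ basepoints σ, (φ (c b) (cycleProd x σ b) * ψ (d b) (cycleProd x σ b)⁻¹) := by
    intro x
    rw [Fc_inv, Finset.prod_mul_distrib]
    unfold Fc
    simp only [mkWr_fst, mkWr_snd]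
    ring
  rw [Finset.sum_congr rfl (fun x _ => h2 x), ← Finset.mul_sum, h1]
  unfold sp
  ring

lemma lhs_eq (φ : T → G → ℚ) (f : T → Multiset ℕ → ℚ) (ψ : Q → G → ℚ) (h : Q → Multiset ℕ → ℚ)
    (hφ : ∀ t, ∀ x g : G, φ t (x * g * x⁻¹) = φ t g)
    (hψ : ∀ q, ∀ x g : G, ψ q (x * g * x⁻¹) = ψ q g)
    (a : T → ℕ) (b : Q → ℕ) (ha : ∑ t, a t = w) (hb : ∑ q, b q = w) :
    sp (zetaTuple a ha φ (fun t σ => f t (cycM σ))) (zetaTuple b hb ψ (fun q σ => h q (cycM σ)))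
    = (w.factorial : ℚ)⁻¹ * ∑ σ : Equiv.Perm (Fin w), ∑ e : Fin w → T × Q,
      (if ∀ j, e (σ j) = e j then Rw f h (fun t q => sp (φ t) (ψ q)) a b (Tc σ e) else 0) := by
  have hG : (Fintype.card G : ℚ) ≠ 0 := by exact_mod_cast Fintype.card_ne_zero
  rw [sp_def, Wr.card, sum_mkWr]
  simp only [zeta_col φ f hφ, zeta_col ψ h hψ]
  -- per permutation
  have key : ∀ σ : Equiv.Perm (Fin w), ∑ x : Fin w → G,
      (∑ c : Fin w → T, if (∀ t, (Finset.univ.filter (fun j => c j = t)).card = a t) then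
          (if ∀ j, c ((mkWr x σ).2 j) = c j then Fc φ f (mkWr x σ) c else 0) else 0) *
      (∑ d : Fin w → Q, if (∀ q, (Finset.univ.filter (fun j => d j = q)).card = b q) then
          (if ∀ j, d (((mkWr x σ)⁻¹).2 j) = d j then Fc ψ h (mkWr x σ)⁻¹ d else 0)
          else 0)
      = (Fintype.card G : ℚ) ^ w * ∑ e : Fin w → T × Q,
      (if ∀ j, e (σ j) = e j then Rw f h (fun t q => sp (φ t) (ψ q)) a b (Tc σ e) else 0) := by
    intro σ
    simp only [Finset.sum_mul_sum]
    rw [Finset.sum_comm]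
    have h1 : ∀ F : (Fin w → T) → (Fin w → Q) → ℚ, ∑ c, ∑ d, F c d
        = ∑ e : Fin w → T × Q, F (fun j => (e j).1) (fun j => (e j).2) := by
      intro F
      rw [← Fintype.sum_prod_type' F]
      exact (Equiv.sum_comp (Equiv.arrowProdEquivProdArrow (Fin w) (fun _ => T) (fun _ => Q))
        (fun p => F p.1 p.2)).symm
    rw [Finset.sum_congr rfl (fun c _ => Finset.sum_comm), h1, Finset.mul_sum]
    refine Finset.sum_congr rfl fun e _ => ?_
    by_cases he : ∀ j, e (σ j) = e j
    · have hc : ∀ j, (e (σ j)).1 = (e j).1 := fun j => by rw [he]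
      have hd : ∀ j, (e (σ⁻¹ j)).2 = (e j).2 := fun j => by
        have := he (σ⁻¹ j)
        rw [show σ (σ⁻¹ j) = j by simp] at this
        rw [this]
      have hd' : ∀ j, (e (σ j)).2 = (e j).2 := fun j => by rw [he]
      have s1 : (∀ t, (Finset.univ.filter (fun j => (e j).1 = t)).card = a t) ↔
          ∀ t, a t = ∑ q, (Tc σ e (t, q)).sum := by
        refine forall_congr' fun t => ?_
        rw [← Tc_sum σ (fun j => (e j).1) hc, Tc_fst, Multiset.sum_sum]
        exact eq_comm
      have s2 : (∀ q, (Finset.univ.filter (fun j => (e j).2 = q)).card = b q) ↔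
          ∀ q, b q = ∑ t, (Tc σ e (t, q)).sum := by
        refine forall_congr' fun q => ?_
        rw [← Tc_sum σ (fun j => (e j).2) hd', Tc_snd, Multiset.sum_sum]
        exact eq_comm
      rw [if_pos he]
      unfold Rw
      by_cases hs : (∀ t, a t = ∑ q, (Tc σ e (t, q)).sum) ∧
          (∀ q, b q = ∑ t, (Tc σ e (t, q)).sum)
      · rw [if_pos hs]
        have t1 := s1.2 hs.1
        have t2 := s2.2 hs.2
        have h3 := Fc_sum φ f ψ h σ (fun j => (e j).1) (fun j => (e j).2)
        have h4 := Tc_pow σ e (fun p => sp (φ p.1) (ψ p.2))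
        rw [Fintype.prod_prod_type] at h4
        simp only [Tc_fst, Tc_snd] at h3
        rw [← h4, ← h3]
        refine Finset.sum_congr rfl fun x _ => ?_
        rw [if_pos t1, if_pos t2]
        congr 1
        · exact if_pos hc
        · exact if_pos hd
      · rw [if_neg hs, mul_zero]
        apply Finset.sum_eq_zero
        intro x _
        by_cases t1 : ∀ t, a t = ∑ q, (Tc σ e (t, q)).sum
        · rw [if_neg (c := ∀ q, (Finset.univ.filter (fun j => (e j).2 = q)).card = b q)
            (fun t2 => hs ⟨t1, s2.1 t2⟩), mul_zero]
        · rw [if_neg (fun t2 => t1 (s1.1 t2)), zero_mul]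
    · rw [if_neg he, mul_zero]
      apply Finset.sum_eq_zero
      intro x _
      by_cases hc : ∀ j, (e (σ j)).1 = (e j).1
      · by_cases hd : ∀ j, (e (σ⁻¹ j)).2 = (e j).2
        · exfalso
          apply he
          intro j
          refine Prod.ext (hc j) ?_
          have := hd (σ j)
          rw [show σ⁻¹ (σ j) = j by simp] at this
          exact this.symm
        · have : ¬ ∀ j, (e (((mkWr x σ)⁻¹).2 j)).2 = (e j).2 := hd
          simp only [if_neg this, ite_self, mul_zero]
      · have : ¬ ∀ j, (e ((mkWr x σ).2 j)).1 = (e j).1 := hc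
        simp only [if_neg this, ite_self, zero_mul]
  rw [Finset.sum_congr rfl (fun σ _ => key σ)]
  rw [← Finset.mul_sum]
  push_cast
  field_simp

end final

/-- **Lemma 3.6.** Let `φ : T → CF(G)` and `ψ : Q → CF(G)` be arbitrary maps, and let `A` be
the `T × Q`-matrix with `A_{tq} = ⟨φ(t), ψ(q)⟩`. Then for all `λ̲ ∈ PMap_w(T)` and
`μ̲ ∈ PMap_w(Q)`, `⟨ζ^{(φ)}_{λ̲}, ζ^{(ψ)}_{μ̲}⟩ = A^{≀w}(s,s)_{λ̲ μ̲}`. -/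
theorem zeta_pairing_wr {G : Type*} [Group G] [Fintype G] {T Q : Type*}
    [Fintype T] [Fintype Q] (φ : T → G → ℚ) (ψ : Q → G → ℚ)
    (hφ : ∀ t, ∀ x g : G, φ t (x * g * x⁻¹) = φ t g)
    (hψ : ∀ q, ∀ x g : G, ψ q (x * g * x⁻¹) = ψ q g)
    {w : ℕ} (lam : T → PttAll) (mu : Q → PttAll)
    (hlam : ∑ t, (lam t).1 = w) (hmu : ∑ q, (mu q).1 = w) :
    sp (zetaTuple (fun t => (lam t).1) hlam φ (fun t => sFun (lam t).2))
       (zetaTuple (fun q => (mu q).1) hmu ψ (fun q => sFun (mu q).2))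
      = wrS (fun t q => sp (φ t) (ψ q)) lam mu := by
  have h := lhs_eq φ (fun t => sval (lam t).2.parts) ψ (fun q => sval (mu q).2.parts) hφ hψ
    (fun t => (lam t).1) (fun q => (mu q).1) hlam hmu
  have h2 := count_main (w := w) (Rw (fun t => sval (lam t).2.parts)
    (fun q => sval (mu q).2.parts) (fun t q => sp (φ t) (ψ q))
    (fun t => (lam t).1) (fun q => (mu q).1)) (by
      intro nu hnu
      unfold Rw at hnu
      rw [ne_eq, ite_eq_right_iff, Classical.not_imp] at hnu
      rw [← hlam, Fintype.sum_prod_type]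
      refine Finset.sum_congr rfl fun t _ => ?_
      have h3 := hnu.1.1 t
      simp only [Nat.Partition.parts_sum] at h3
      exact h3.symm)
  refine h.trans (Eq.trans ?_ (h2.trans ?_))
  · congr!
  · exact finsum_congr fun nu => (wr_term _ lam mu nu).symm

end
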